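/- Let F_2 be the polynomial in Q[b,c,d,e,f] given by F_2 = b^2cd^4 - 2b^2cd^3 + b^2cd^2 + 2b^2d^3ef - 5b^2d^2ef + 4b^2def - b^2ef - 2b^2d^4e + 3b^2d^3e + b^2d^2e - 3b^2de + b^2e - 2b^2d^4f + 3b^2d^3f + b^2d^2f - 3b^2df + b^2f + 2b^2d^5 - 3b^2d^4 + 2b^2d - b^2 + bc^2d^3 - bc^2d^2 + bcd^2ef - 3bcdef + 2bcef - 2bcd^3e + 2bcd^2e + 2bcde - 2bce - 2bcd^3f + 2bcd^2f + 2bcdf - 2bcf + bcd^4 - 2bcd^2 - bcd + 2bc - 2bd^2e^2f + 4bde^2f - 2be^2f + 2bd^3e^2 - 2bd^2e^2 - 2bde^2 + 2be^2 - 2bd^2ef^2 + 4bdef^2 - 2bef^2 + 4bd^3ef - bd^2ef - 7bdef + 4bef - 2bd^4e - bd^3e + 4bd^2e + bde - 2be + 2bd^3f^2 - 2bd^2f^2 - 2bdf^2 + 2bf^2 - 2bd^4f - bd^3f + 4bd^2f + bdf - 2bf + 3bd^4 - 3bd^3 - bd^2 + bd - c^2def - c^2ef + c^2de + c^2e + c^2df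 + c^2f - c^2d - c^2 + 2ce^2f - 2ce^2 + 2cef^2 + cd^2ef - cdef - 4cef - cd^2e + cde + 2ce - 2cf^2 - cd^2f + cdf + 2cf + cd^2 - cd + 2de^2f^2 - 4e^2f^2 - 2d^2e^2f + 4e^2f + 2d^2e^2 - 2de^2 - 2d^2ef^2 + 4ef^2 + 2d^3ef + 2d^2ef - 2def - 4ef - 2d^3e + 2de + 2d^2f^2 - 2df^2 - 2d^3f + 2df + 2d^3 - 2d^2. Then the set of pairs (e,f) in Q x Q with F_2(-1, 5/4, -1, e, f) = 0 is infinite. -/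

import Mathlib

/-- The polynomial `F₂` from Section 5 of the paper, as a function `ℚ⁵ → ℚ`. -/
def F2 (b c d e f : ℚ) : ℚ :=
  b^2*c*d^4 - 2*b^2*c*d^3 + b^2*c*d^2 + 2*b^2*d^3*e*f - 5*b^2*d^2*e*f + 4*b^2*d*e*f -
  b^2*e*f - 2*b^2*d^4*e + 3*b^2*d^3*e + b^2*d^2*e - 3*b^2*d*e + b^2*e - 2*b^2*d^4*f +
  3*b^2*d^3*f + b^2*d^2*f - 3*b^2*d*f + b^2*f + 2*b^2*d^5 - 3*b^2*d^4 + 2*b^2*d - b^2 +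
  b*c^2*d^3 - b*c^2*d^2 + b*c*d^2*e*f - 3*b*c*d*e*f + 2*b*c*e*f - 2*b*c*d^3*e + 2*b*c*d^2*e
  + 2*b*c*d*e - 2*b*c*e - 2*b*c*d^3*f + 2*b*c*d^2*f + 2*b*c*d*f - 2*b*c*f + b*c*d^4 -
  2*b*c*d^2 - b*c*d + 2*b*c - 2*b*d^2*e^2*f + 4*b*d*e^2*f - 2*b*e^2*f + 2*b*d^3*e^2 -
  2*b*d^2*e^2 - 2*b*d*e^2 + 2*b*e^2 - 2*b*d^2*e*f^2 + 4*b*d*e*f^2 - 2*b*e*f^2 + 4*b*d^3*e*f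
  - b*d^2*e*f - 7*b*d*e*f + 4*b*e*f - 2*b*d^4*e - b*d^3*e + 4*b*d^2*e + b*d*e - 2*b*e +
  2*b*d^3*f^2 - 2*b*d^2*f^2 - 2*b*d*f^2 + 2*b*f^2 - 2*b*d^4*f - b*d^3*f + 4*b*d^2*f + b*d*f
  - 2*b*f + 3*b*d^4 - 3*b*d^3 - b*d^2 + b*d - c^2*d*e*f - c^2*e*f + c^2*d*e + c^2*e +
  c^2*d*f + c^2*f - c^2*d - c^2 + 2*c*e^2*f - 2*c*e^2 + 2*c*e*f^2 + c*d^2*e*f - c*d*e*f -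
  4*c*e*f - c*d^2*e + c*d*e + 2*c*e - 2*c*f^2 - c*d^2*f + c*d*f + 2*c*f + c*d^2 - c*d +
  2*d*e^2*f^2 - 4*e^2*f^2 - 2*d^2*e^2*f + 4*e^2*f + 2*d^2*e^2 - 2*d*e^2 - 2*d^2*e*f^2 +
  4*e*f^2 + 2*d^3*e*f + 2*d^2*e*f - 2*d*e*f - 4*e*f - 2*d^3*e + 2*d*e + 2*d^2*f^2 - 2*d*f^2
  - 2*d^3*f + 2*d*f + 2*d^3 - 2*d^2

theorem hp_dom {a b : ℚ} (h : padicNorm 2 b < padicNorm 2 a) :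
    padicNorm 2 (a + b) = padicNorm 2 a := by
  have : Fact (Nat.Prime 2) := ⟨Nat.prime_two⟩
  rw [padicNorm.add_eq_max_of_ne h.ne', max_eq_left h.le]

theorem hp_quart (a b c d k : ℤ) (x : ℚ) (ha : padicNorm 2 (a : ℚ) = 1) (hx : 1 < padicNorm 2 x) :
    padicNorm 2 (a * x ^ 4 + (b * x ^ 3 + c * x ^ 2 + d * x + k)) = padicNorm 2 x ^ 4 := by
  have : Fact (Nat.Prime 2) := ⟨Nat.prime_two⟩
  have hpow : ∀ m : ℕ, padicNorm 2 (x ^ m) = padicNorm 2 x ^ m := fun m => by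
    induction m with
    | zero => simp
    | succ m ih => rw [pow_succ, padicNorm.mul, ih, pow_succ]
  have h4 : padicNorm 2 (a * x ^ 4) = padicNorm 2 x ^ 4 := by
    rw [padicNorm.mul, ha, hpow, one_mul]
  have hb : ∀ (z : ℤ) (m : ℕ), m ≤ 3 → padicNorm 2 (z * x ^ m) ≤ padicNorm 2 x ^ 3 := by
    intro z m hm
    rw [padicNorm.mul, hpow]
    calc _ ≤ 1 * padicNorm 2 x ^ m :=
          mul_le_mul_of_nonneg_right (padicNorm.of_int z) (by positivity)
      _ = padicNorm 2 x ^ m := one_mul _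
      _ ≤ _ := pow_le_pow_right₀ hx.le hm
  rw [hp_dom, h4]
  rw [h4]
  have e3 := hb b 3 le_rfl
  have e2 := hb c 2 (by norm_num)
  have e1 := hb d 1 (by norm_num)
  have e0 := hb k 0 (by norm_num)
  rw [pow_one] at e1
  rw [pow_zero, mul_one] at e0
  have s1 := (padicNorm.nonarchimedean (p := 2) (q := b * x ^ 3) (r := c * x ^ 2)).trans
    (max_le e3 e2)
  have s2 := (padicNorm.nonarchimedean (p := 2) (q := b * x ^ 3 + c * x ^ 2) (r := d * x)).trans
    (max_le s1 e1)
  have s3 := (padicNorm.nonarchimedean (p := 2) (q := b * x ^ 3 + c * x ^ 2 + d * x)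
    (r := k)).trans (max_le s2 e0)
  exact s3.trans_lt (pow_lt_pow_right₀ hx (by norm_num))

theorem hp_cub (a b c d : ℤ) (x : ℚ) (ha : padicNorm 2 (a : ℚ) = 1) (hx : 1 < padicNorm 2 x) :
    padicNorm 2 (a * x ^ 3 + b * x ^ 2 + c * x + d) = padicNorm 2 x ^ 3 := by
  have : Fact (Nat.Prime 2) := ⟨Nat.prime_two⟩
  have h := hp_quart a b c d 0 x ha hx
  have e : (a * x ^ 4 + (b * x ^ 3 + c * x ^ 2 + d * x + (0 : ℤ)) : ℚ)
    = (a * x ^ 3 + b * x ^ 2 + c * x + d) * x := by push_cast; ring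
  rw [e, padicNorm.mul] at h
  have : padicNorm 2 x ≠ 0 := by linarith
  apply mul_right_cancel₀ this
  rw [h]; ring

theorem hp_ne (a b c d : ℤ) (x : ℚ) (ha : padicNorm 2 (a : ℚ) = 1) (hx : 1 < padicNorm 2 x) :
    a * x ^ 3 + b * x ^ 2 + c * x + d ≠ 0 := by
  intro h
  have := hp_cub a b c d x ha hx
  rw [h, padicNorm.zero] at this
  have : 0 < padicNorm 2 x ^ 3 := by positivity
  linarith

theorem hp_odd (a : ℤ) (h : ¬ (2 : ℤ) ∣ a) : padicNorm 2 (a : ℚ) = 1 := by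
  have : Fact (Nat.Prime 2) := ⟨Nat.prime_two⟩
  exact (padicNorm.int_eq_one_iff a).2 (by exact_mod_cast h)

theorem hp_pts (n : ℕ) : ∃ x Y : ℚ, Y ^ 2 = x ^ 3 - 8424 * x ^ 2 - 110859840 * x + 956049998400 ∧
    padicNorm 2 x = 4 ^ (n + 1) := by
  have : Fact (Nat.Prime 2) := ⟨Nat.prime_two⟩
  induction n with
  | zero =>
    refine ⟨5083861896409/307300900, (-6245851396794621427/5386984777000), by norm_num, ?_⟩
    have e : (5083861896409/307300900 : ℚ) = (5083861896409 : ℤ) / ((76825225 : ℤ) * ((2 : ℕ) * (2 : ℕ))) := by norm_num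
    rw [e, padicNorm.div, padicNorm.mul, padicNorm.mul, padicNorm.padicNorm_p_of_prime,
      hp_odd _ (by norm_num), hp_odd _ (by norm_num)]
    norm_num
  | succ n ih =>
    obtain ⟨x, Y, h, hx⟩ := ih
    have hx1 : 1 < padicNorm 2 x := by
      rw [hx]; exact one_lt_pow₀ (by norm_num) (by omega)
    have hY2 : padicNorm 2 (Y ^ 2) = padicNorm 2 x ^ 3 := by
      rw [h, ← hp_cub 1 (-8424) (-110859840) 956049998400 x (hp_odd _ (by norm_num)) hx1]
      congr 1; push_cast; ring
    have hN : padicNorm 2 x ≠ 0 := by linarith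
    have hY : Y ≠ 0 := by
      rintro rfl
      norm_num at hY2
      exact hN (pow_eq_zero_iff (by norm_num) |>.1 hY2.symm)
    have hnum := hp_quart 1 0 (-2 * -110859840) (-8 * 956049998400)
      ((-110859840)^2 - 4 * -8424 * 956049998400) x (hp_odd _ (by norm_num)) hx1
    obtain ⟨l, hl⟩ : ∃ l, l = (3 * x ^ 2 - 2 * 8424 * x - 110859840) / (2 * Y) := ⟨_, rfl⟩
    have hl' : l * (2 * Y) = 3 * x ^ 2 - 2 * 8424 * x - 110859840 := by
      rw [hl]; field_simp
    obtain ⟨X, hX⟩ : ∃ X, X = l ^ 2 + 8424 - 2 * x := ⟨_, rfl⟩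
    refine ⟨X, -(Y + l * (X - x)), ?_, ?_⟩
    · have : (X - x) * ((Y + l * (X - x)) ^ 2 -
        (X ^ 3 - 8424 * X ^ 2 - 110859840 * X + 956049998400)) = 0 := by
        linear_combination (exp := 1) (X - x) * h + (X - x) ^ 2 * hl' - (X - x) ^ 3 * hX
      rw [neg_sq]
      linear_combination h + (X - x) * hl' - (X - x) ^ 2 * hX
    · have e : X * ((2 : ℕ) * (2 : ℕ) * Y ^ 2) = (1 : ℤ) * x ^ 4 + ((0 : ℤ) * x ^ 3 +
          (-2 * -110859840 : ℤ) * x ^ 2 + (-8 * 956049998400 : ℤ) * x +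
          ((-110859840)^2 - 4 * -8424 * 956049998400 : ℤ)) := by
        push_cast
        rw [hX]
        linear_combination (l * (2 * Y) + (3 * x ^ 2 - 2 * 8424 * x - 110859840)) * hl'
          + (4 * 8424 - 8 * x) * h
      rw [← e, padicNorm.mul, padicNorm.mul, padicNorm.mul, padicNorm.padicNorm_p_of_prime,
        hY2] at hnum
      have h3 : padicNorm 2 x ^ 3 ≠ 0 := pow_ne_zero _ hN
      have : padicNorm 2 X = 4 * padicNorm 2 x := by
        apply mul_right_cancel₀ h3
        push_cast at hnum
        linear_combination 4 * hnum
      rw [this, hx]; ring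

/-- Recover `x` from `(e, f)`. -/
def hp_g (p : ℚ × ℚ) : ℚ :=
  let s := 2 * ((p.1 * p.2 + 1 / 4) / (p.1 + p.2))
  let v := (p.1 - p.2) * (12 + 50 * s - 12 * s ^ 2)
  (190 * (v + 95) + 3360 * (s - 1)) / (s - 1) ^ 2

theorem hp_D (s : ℚ) : 12 + 50 * s - 12 * s ^ 2 ≠ 0 := by
  intro h
  have h1 : IsSquare (769 : ℚ) := ⟨12 * s - 25, by linear_combination 12 * h⟩
  rw [Rat.isSquare_iff] at h1
  have h2 : IsSquare (769 : ℤ) := by simpa using h1.1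
  obtain ⟨r, hr⟩ := h2
  have : r < 28 := by nlinarith
  have : -28 < r := by nlinarith
  interval_cases r <;> omega

theorem hp_main (x Y : ℚ)
    (h : Y ^ 2 = x ^ 3 - 8424 * x ^ 2 - 110859840 * x + 956049998400)
    (hx : 1 < padicNorm 2 x) :
    ∃ p : ℚ × ℚ, F2 (-1) (5/4) (-1) p.1 p.2 = 0 ∧ hp_g p = x := by
  have : Fact (Nat.Prime 2) := ⟨Nat.prime_two⟩
  obtain ⟨y, hy⟩ : ∃ y, y = Y - (336 / 19 * x - 47880) := ⟨_, rfl⟩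
  have hy0 : y ≠ 0 := by
    intro h0
    apply hp_ne 361 (361 * -8424 - 336 ^ 2) (361 * -110859840 + 2 * 336 * 909720)
      (361 * 956049998400 - 909720 ^ 2) x (hp_odd _ (by norm_num)) hx
    have : Y = 336 / 19 * x - 47880 := by linarith
    rw [this] at h
    push_cast
    linear_combination -361 * h
  have hlin : ∀ a b : ℤ, ¬ (2 : ℤ) ∣ a → a * x + b ≠ 0 := by
    intro a b ha h0
    apply hp_ne a b 0 0 x (hp_odd _ ha) hx
    push_cast
    linear_combination x ^ 2 * h0
  have hc : 190 * (x - 8424) - 3360 ^ 2 / 190 ≠ 0 := by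
    intro h0
    apply hlin 361 (-361 * 8424 - 336 ^ 2) (by norm_num)
    push_cast
    linear_combination 361 / 190 * h0
  obtain ⟨u, hu⟩ : ∃ u, u = (190 * (x - 8424) - 3360 ^ 2 / 190) / y := ⟨_, rfl⟩
  have hu0 : u ≠ 0 := by rw [hu]; exact div_ne_zero hc hy0
  have huy : u * y = 190 * (x - 8424) - 3360 ^ 2 / 190 := by rw [hu]; field_simp
  obtain ⟨v, hv⟩ : ∃ v, v = -95 + u * (u * x - 3360) / 190 := ⟨_, rfl⟩
  have hxv : x * u ^ 2 = 190 * (v + 95) + 3360 * u := by rw [hv]; ring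
  have hq : v ^ 2 = 3024 * u ^ 4 - 504 * u ^ 3 - 8424 * u ^ 2 + 3360 * u + 9025 := by
    have hK : u ^ 2 * (x ^ 2 - 36100 * 3024) - 2 * u * (3360 * x - 2 * 9025 * 504)
        - 36100 * (x - 8424 - 3360 ^ 2 / 36100) = 0 := by
      have : y ^ 2 * (u ^ 2 * (x ^ 2 - 36100 * 3024) - 2 * u * (3360 * x - 2 * 9025 * 504)
        - 36100 * (x - 8424 - 3360 ^ 2 / 36100)) = 0 := by
        have hE : y ^ 2 + 3360 / 95 * x * y - 190 * 504 * y
            = (x - 8424 - 3360 ^ 2 / 36100) * (x ^ 2 - 36100 * 3024) := by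
          rw [hy]
          linear_combination h
        linear_combination ((u * y + 190 * (x - 8424) - 3360 ^ 2 / 190) *
          (x ^ 2 - 36100 * 3024) - 2 * y * (3360 * x - 2 * 9025 * 504)) * huy
          - 36100 * (x - 8424 - 3360 ^ 2 / 36100) * hE
      exact (mul_eq_zero.1 this).resolve_left (pow_ne_zero _ hy0)
    rw [hv]
    linear_combination u ^ 2 / 36100 * hK
  have hs5 : 25 + 120 * (1 + u) ≠ 0 := by
    intro h0
    have hu5 : u = -29 / 24 := by linarith
    rw [hu5] at hq hxv
    have : (v - 17 / 16) * (v + 17 / 16) = 0 := by linear_combination hq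
    rcases mul_eq_zero.1 this with h1 | h1
    · apply hlin 1 (-9720) (by norm_num)
      push_cast
      linear_combination 576 / 841 * hxv + 576 / 841 * 190 * h1
    · apply hlin 841 (-7941960) (by norm_num)
      push_cast
      linear_combination 576 * hxv + 576 * 190 * h1
  obtain ⟨s, hs⟩ : ∃ s, s = 1 + u := ⟨_, rfl⟩
  have hD := hp_D s
  obtain ⟨D, hDd⟩ : ∃ D, D = 12 + 50 * s - 12 * s ^ 2 := ⟨_, rfl⟩
  rw [← hDd] at hD
  rw [← hs] at hs5
  have hus : u = s - 1 := by linarith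
  refine ⟨(((25 + 120 * s) / D + v / D) / 2, ((25 + 120 * s) / D - v / D) / 2), ?_, ?_⟩
  · have hP : ((25 + 120 * s) / D + v / D) / 2 * (((25 + 120 * s) / D - v / D) / 2)
        = s / 2 * ((25 + 120 * s) / D) - 1 / 4 := by
      field_simp
      rw [hus] at hq
      rw [hDd]
      linear_combination -4 * hq
    have hU : (25 + 120 * s) / D * (12 + 50 * s - 12 * s ^ 2) = 25 + 120 * s := by
      rw [← hDd]; field_simp
    generalize (25 + 120 * s) / D = U at hP hU ⊢
    generalize v / D = W at hP ⊢
    simp only [F2]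
    linear_combination (-6 * ((U + W) / 2 * ((U - W) / 2) + (s / 2 * U - 1 / 4))
      + 25 / 2 * U - 33) * hP + U / 8 * hU
  · have e1 : ((25 + 120 * s) / D + v / D) / 2 + ((25 + 120 * s) / D - v / D) / 2
      = (25 + 120 * s) / D := by ring
    have e2 : ((25 + 120 * s) / D + v / D) / 2 - ((25 + 120 * s) / D - v / D) / 2
      = v / D := by ring
    have hss : 2 * ((((25 + 120 * s) / D + v / D) / 2 * (((25 + 120 * s) / D - v / D) / 2)
        + 1 / 4) / ((25 + 120 * s) / D)) = s := by
      field_simp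
      rw [hus] at hq
      rw [hDd]
      linear_combination -4 * hq
    simp only [hp_g]
    rw [e1, hss, e2, ← hDd, div_mul_cancel₀ _ hD, ← hus, ← hxv]
    field_simp

/-- The set of pairs `(e,f) ∈ ℚ²` with `F₂(-1, 5/4, -1, e, f) = 0` is infinite. -/
theorem stmt19 : {p : ℚ × ℚ | F2 (-1) (5/4) (-1) p.1 p.2 = 0}.Infinite := by
  apply Set.Infinite.of_image (fun p => padicNorm 2 (hp_g p))
  have hinj : Function.Injective (fun n : ℕ => (4 : ℚ) ^ (n + 1)) := by
    intro a b hab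
    have := pow_right_injective₀ (a := (4 : ℚ)) (by norm_num) (by norm_num) hab
    omega
  refine (Set.infinite_range_of_injective hinj).mono ?_
  rintro _ ⟨n, rfl⟩
  obtain ⟨x, Y, h, hx⟩ := hp_pts n
  obtain ⟨p, hp, hg⟩ := hp_main x Y h (by rw [hx]; exact one_lt_pow₀ (by norm_num) (by omega))
  exact ⟨p, hp, by simp only [hg, hx]⟩
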